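/- arXiv:1308.1067 — 2 statements merged into one kernel-verified Lean document; each statement's English description precedes it below -/
import Mathlib

section
/- Let ξ_1, …, ξ_m and H be nonnegative random variables on a probability space such that H ≥ ξ_1 + ⋯ + ξ_m almost surely. Suppose there are constants p ∈ (0,1) and a > 0 such that for every i ∈ {1,…,m} and every t > 0 one has P(ξ_i ≤ t | σ(ξ_1,…,ξ_{i−1})) ≤ p + a·t almost surely (for i = 1 this means P(ξ_1 ≤ t) ≤ p + a·t). Then for every t > 0, log P(H ≤ t) ≤ 2·(a·m·t/p)^{1/2} − m·log(1/p). -/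
open MeasureTheory ProbabilityTheory

/-- The σ-algebra generated by `ξ 0, …, ξ (i-1)` (trivial σ-algebra for `i = 0`). -/
def pastSigma {Ω : Type*} [MeasurableSpace Ω] {m : ℕ} (ξ : Fin m → Ω → ℝ) (i : Fin m) :
    MeasurableSpace Ω :=
  ⨆ j : Fin m, ⨆ _ : (j : ℕ) < (i : ℕ), MeasurableSpace.comap (ξ j) inferInstance

lemma setLIntegral_ofReal_le_of_condExp_indicator_le {Ω : Type*} {m m₀ : MeasurableSpace Ω}
    {P : Measure Ω} [IsProbabilityMeasure P] (hm : m ≤ m₀) {S : Set Ω} (hS : MeasurableSet S)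
    {W : Ω → ℝ} (hW : Measurable[m] W) (hW0 : ∀ x, 0 ≤ W x) (hW1 : ∀ x, W x ≤ 1) {c : ℝ}
    (hc : ∀ᵐ x ∂P, (P[S.indicator (fun _ => (1 : ℝ)) | m]) x ≤ c) :
    ∫⁻ x in S, ENNReal.ofReal (W x) ∂P ≤ ENNReal.ofReal c * ∫⁻ x, ENNReal.ofReal (W x) ∂P := by
  have hWm : Measurable W := hW.mono hm le_rfl
  have hWi : Integrable W P := by
    refine Integrable.of_bound hWm.aestronglyMeasurable 1 (ae_of_all _ fun x => ?_)
    rw [Real.norm_eq_abs, abs_of_nonneg (hW0 x)]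
    exact hW1 x
  have hSi : Integrable (S.indicator (fun _ => (1 : ℝ))) P := (integrable_const _).indicator hS
  have hmul : W * S.indicator (fun _ => (1 : ℝ)) = S.indicator W := by
    ext x
    by_cases hx : x ∈ S <;> simp [hx]
  have hprod : Integrable (W * S.indicator (fun _ => (1 : ℝ))) P := by
    rw [hmul]
    exact hWi.indicator hS
  have hpull := condExp_mul_of_stronglyMeasurable_left (μ := P) hW.stronglyMeasurable hprod hSi
  rw [← ofReal_integral_eq_lintegral_ofReal hWi.integrableOn (ae_of_all _ hW0),
    ← ofReal_integral_eq_lintegral_ofReal hWi (ae_of_all _ hW0),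
    ← ENNReal.ofReal_mul' (integral_nonneg hW0)]
  refine ENNReal.ofReal_le_ofReal ?_
  calc ∫ x in S, W x ∂P = ∫ x, (P[W * S.indicator (fun _ => (1 : ℝ)) | m]) x ∂P := by
        rw [integral_condExp hm, hmul, integral_indicator hS]
    _ ≤ ∫ x, c * W x ∂P := by
        refine integral_mono_ae integrable_condExp (hWi.const_mul c) ?_
        filter_upwards [hpull, hc] with x hx hcx
        rw [hx, Pi.mul_apply, mul_comm c]
        exact mul_le_mul_of_nonneg_left hcx (hW0 x)
    _ = c * ∫ x, W x ∂P := integral_const_mul _ _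

lemma lintegral_Ioi_mul_exp_neg {l : ℝ} (hl : 0 < l) (x : ℝ) :
    ∫⁻ t in Set.Ioi x, ENNReal.ofReal (l * Real.exp (-l * t)) =
      ENNReal.ofReal (Real.exp (-l * x)) := by
  have hneg : -l < 0 := neg_lt_zero.2 hl
  rw [← ofReal_integral_eq_lintegral_ofReal
    ((integrableOn_exp_mul_Ioi hneg x).const_mul l) (ae_of_all _ fun t => by positivity),
    integral_const_mul, integral_exp_mul_Ioi hneg]
  congr 1
  field_simp

lemma lintegral_Ioi_mul_exp_neg_mul_affine {l p a : ℝ} (hl : 0 < l) (hp : 0 ≤ p) (ha : 0 ≤ a) :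
    ∫⁻ t in Set.Ioi (0 : ℝ),
        ENNReal.ofReal (l * Real.exp (-l * t)) * ENNReal.ofReal (p + a * t) =
      ENNReal.ofReal (p + a / l) := by
  have hneg : -l < 0 := neg_lt_zero.2 hl
  have hlin : ∫ t in Set.Ioi (0 : ℝ), t * Real.exp (-l * t) = 1 / l ^ 2 := by
    have h := Real.integral_rpow_mul_exp_neg_mul_Ioi (a := 2) (r := l) two_pos hl
    norm_num at h
    simpa using h
  have hlini : IntegrableOn (fun t : ℝ => t * Real.exp (-l * t)) (Set.Ioi 0) :=
    .of_integral_ne_zero (by rw [hlin]; positivity)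
  have hexpi := integrableOn_exp_mul_Ioi hneg 0
  have hsplit : ∀ t : ℝ, l * Real.exp (-l * t) * (p + a * t) =
      l * p * Real.exp (-l * t) + l * a * (t * Real.exp (-l * t)) := fun t => by ring
  simp_rw [← ENNReal.ofReal_mul (mul_nonneg hl.le (Real.exp_nonneg _)), hsplit]
  have h₁ := hexpi.const_mul (l * p)
  have h₂ := hlini.const_mul (l * a)
  rw [← ofReal_integral_eq_lintegral_ofReal (h₁.fun_add h₂), integral_add h₁ h₂,
    integral_const_mul, integral_const_mul, hlin, integral_exp_mul_Ioi hneg]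
  · congr 1
    simp
    field_simp
  · filter_upwards [ae_restrict_mem measurableSet_Ioi] with t ht
    have : 0 < t := ht
    simp only [Pi.zero_apply]
    positivity

lemma lintegral_mul_exp_neg_le_of_condExp_le {Ω : Type*} {m m₀ : MeasurableSpace Ω}
    {P : Measure Ω} [IsProbabilityMeasure P] (hm : m ≤ m₀) {X W : Ω → ℝ} (hX : Measurable X)
    (hX0 : ∀ x, 0 ≤ X x) (hW : Measurable[m] W) (hW0 : ∀ x, 0 ≤ W x) (hW1 : ∀ x, W x ≤ 1)
    {p a l : ℝ} (hp : 0 ≤ p) (ha : 0 ≤ a) (hl : 0 < l)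
    (hcond : ∀ t : ℝ, 0 < t →
      ∀ᵐ x ∂P, (P[Set.indicator {y | X y ≤ t} (fun _ => (1 : ℝ)) | m]) x ≤ p + a * t) :
    ∫⁻ x, ENNReal.ofReal (W x * Real.exp (-l * X x)) ∂P ≤
      ENNReal.ofReal (p + a / l) * ∫⁻ x, ENNReal.ofReal (W x) ∂P := by
  have hWm : Measurable W := hW.mono hm le_rfl
  set f : ℝ → ENNReal := fun t => ENNReal.ofReal (l * Real.exp (-l * t)) with hf
  have hfm : Measurable f := by fun_prop
  set F : Ω × ℝ → ENNReal := {q : Ω × ℝ | X q.1 ≤ q.2}.indicator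
    (fun q => f q.2 * ENNReal.ofReal (W q.1)) with hF
  have hFm : Measurable F :=
    ((hfm.comp measurable_snd).mul (hWm.comp measurable_fst).ennreal_ofReal).indicator
      (measurableSet_le (hX.comp measurable_fst) measurable_snd)
  calc ∫⁻ x, ENNReal.ofReal (W x * Real.exp (-l * X x)) ∂P
      ≤ ∫⁻ x, (∫⁻ t in Set.Ioi (0 : ℝ), F (x, t)) ∂P := by
        refine lintegral_mono fun x => ?_
        rw [ENNReal.ofReal_mul (hW0 x), ← lintegral_Ioi_mul_exp_neg hl, mul_comm,
          ← lintegral_mul_const _ hfm]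
        refine le_trans (le_of_eq ?_) (lintegral_mono_set (Set.Ioi_subset_Ioi (hX0 x)))
        refine setLIntegral_congr_fun measurableSet_Ioi fun t ht => ?_
        have ht' : X x ≤ t := le_of_lt ht
        simp [hF, hf, ht']
    _ = ∫⁻ t in Set.Ioi (0 : ℝ), ∫⁻ x, F (x, t) ∂P :=
        lintegral_lintegral_swap (f := fun x t => F (x, t)) hFm.aemeasurable
    _ ≤ ∫⁻ t in Set.Ioi (0 : ℝ),
          f t * ENNReal.ofReal (p + a * t) * ∫⁻ x, ENNReal.ofReal (W x) ∂P := by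
        refine setLIntegral_mono' measurableSet_Ioi fun t ht => ?_
        have hS : MeasurableSet {y | X y ≤ t} := measurableSet_le hX measurable_const
        have hsec : ∀ x, F (x, t) =
            {y | X y ≤ t}.indicator (fun y => f t * ENNReal.ofReal (W y)) x := fun x => by
          simp [hF, Set.indicator_apply]
        simp_rw [hsec]
        rw [lintegral_indicator hS, lintegral_const_mul _ hWm.ennreal_ofReal, mul_assoc]
        gcongr
        exact setLIntegral_ofReal_le_of_condExp_indicator_le hm hS hW hW0 hW1 (hcond t ht)
    _ = ENNReal.ofReal (p + a / l) * ∫⁻ x, ENNReal.ofReal (W x) ∂P := by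
        rw [lintegral_mul_const _ (by fun_prop), lintegral_Ioi_mul_exp_neg_mul_affine hl hp ha]

lemma pastSigma_le {Ω : Type*} [m₀ : MeasurableSpace Ω] {m : ℕ} {ξ : Fin m → Ω → ℝ}
    (hξ : ∀ i, Measurable (ξ i)) (i : Fin m) : pastSigma ξ i ≤ m₀ :=
  iSup₂_le fun j _ => (hξ j).comap_le

lemma measurable_pastSigma {Ω : Type*} [MeasurableSpace Ω] {m : ℕ} (ξ : Fin m → Ω → ℝ)
    {i j : Fin m} (hji : j < i) : Measurable[pastSigma ξ i] (ξ j) :=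
  (comap_measurable (ξ j)).mono
    (le_iSup₂_of_le (f := fun (j : Fin m) (_ : (j : ℕ) < i) =>
      MeasurableSpace.comap (ξ j) inferInstance) j hji le_rfl) le_rfl

lemma lintegral_exp_neg_sum_le {Ω : Type*} [MeasurableSpace Ω] {P : Measure Ω}
    [IsProbabilityMeasure P] {m : ℕ} {ξ : Fin m → Ω → ℝ} (hξ : ∀ i, Measurable (ξ i))
    (hξ0 : ∀ i x, 0 ≤ ξ i x) {p a l : ℝ} (hp : 0 ≤ p) (ha : 0 ≤ a) (hl : 0 < l)
    (hcond : ∀ (i : Fin m) (t : ℝ), 0 < t → ∀ᵐ x ∂P,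
      (P[Set.indicator {y | ξ i y ≤ t} (fun _ => (1 : ℝ)) | pastSigma ξ i]) x ≤ p + a * t)
    {k : ℕ} (hk : k ≤ m) :
    ∫⁻ x, ENNReal.ofReal (Real.exp (-l * ∑ j : Fin m with j.val < k, ξ j x)) ∂P ≤
      ENNReal.ofReal (p + a / l) ^ k := by
  induction k with
  | zero => simp
  | succ k ih =>
    set i : Fin m := ⟨k, hk⟩
    have hins : (Finset.univ.filter fun j : Fin m => j.val < k + 1) =
        insert i (Finset.univ.filter fun j : Fin m => j.val < k) := by
      ext j
      simp only [Finset.mem_filter, Finset.mem_univ, true_and, Finset.mem_insert, Fin.ext_iff, i]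
      omega
    have hstep := lintegral_mul_exp_neg_le_of_condExp_le (P := P) (pastSigma_le hξ i) (hξ i)
      (hξ0 i) (W := fun x => Real.exp (-l * ∑ j : Fin m with j.val < k, ξ j x))
      (by
        refine Real.measurable_exp.comp (Measurable.const_mul ?_ _)
        refine Finset.measurable_fun_sum _ fun j hj => measurable_pastSigma ξ ?_
        simpa [i, Fin.lt_def] using hj)
      (fun x => Real.exp_nonneg _)
      (fun x => Real.exp_le_one_iff.2 (mul_nonpos_of_nonpos_of_nonneg (neg_nonpos.2 hl.le)
        (Finset.sum_nonneg fun j _ => hξ0 j x))) hp ha hl (hcond i)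
    calc ∫⁻ x, ENNReal.ofReal (Real.exp (-l * ∑ j : Fin m with j.val < k + 1, ξ j x)) ∂P
        = ∫⁻ x, ENNReal.ofReal (Real.exp (-l * ∑ j : Fin m with j.val < k, ξ j x) *
            Real.exp (-l * ξ i x)) ∂P := by
          refine lintegral_congr fun x => ?_
          rw [hins, Finset.sum_insert (by simp [i]), ← Real.exp_add]
          congr 2
          ring
      _ ≤ _ := hstep
      _ ≤ ENNReal.ofReal (p + a / l) * ENNReal.ofReal (p + a / l) ^ k := by
          gcongr
          exact ih (by omega)
      _ = ENNReal.ofReal (p + a / l) ^ (k + 1) := (pow_succ' _ _).symm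

lemma measure_le_le_of_lintegral_exp_neg_le {Ω : Type*} [MeasurableSpace Ω] {P : Measure Ω}
    {S H : Ω → ℝ} (hS : Measurable S) (hSH : ∀ᵐ x ∂P, S x ≤ H x) {l C : ℝ} (hl : 0 ≤ l)
    (hC : ∫⁻ x, ENNReal.ofReal (Real.exp (-l * S x)) ∂P ≤ ENNReal.ofReal C) (t : ℝ) :
    P {x | H x ≤ t} ≤ ENNReal.ofReal (Real.exp (l * t) * C) := by
  have hmeas : Measurable fun x => ENNReal.ofReal (Real.exp (l * t) * Real.exp (-l * S x)) := by
    fun_prop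
  calc P {x | H x ≤ t}
      ≤ P {x | 1 ≤ ENNReal.ofReal (Real.exp (l * t) * Real.exp (-l * S x))} := by
        refine measure_mono_ae ?_
        filter_upwards [hSH] with x hx hHx
        have hHt : H x ≤ t := hHx
        change 1 ≤ ENNReal.ofReal _
        rw [ENNReal.one_le_ofReal, ← Real.exp_add, Real.one_le_exp_iff]
        nlinarith [mul_le_mul_of_nonneg_left (hx.trans hHt) hl]
    _ ≤ ∫⁻ x, ENNReal.ofReal (Real.exp (l * t) * Real.exp (-l * S x)) ∂P := by
        simpa using mul_meas_ge_le_lintegral (μ := P) hmeas 1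
    _ = ENNReal.ofReal (Real.exp (l * t)) *
          ∫⁻ x, ENNReal.ofReal (Real.exp (-l * S x)) ∂P := by
        simp_rw [ENNReal.ofReal_mul (Real.exp_nonneg (l * t))]
        exact lintegral_const_mul _ (by fun_prop)
    _ ≤ ENNReal.ofReal (Real.exp (l * t) * C) := by
        rw [ENNReal.ofReal_mul (Real.exp_nonneg _)]
        gcongr

lemma exp_mul_add_div_pow_le {p a l t : ℝ} (hp : 0 < p) (ha : 0 ≤ a) (hl : 0 < l) (m : ℕ) :
    Real.exp (l * t) * (p + a / l) ^ m ≤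
      Real.exp (l * t + m * (a / (l * p)) - m * Real.log (1 / p)) := by
  have hbase : p + a / l ≤ Real.exp (Real.log p + a / (l * p)) := by
    rw [Real.exp_add, Real.exp_log hp]
    calc p + a / l = p * (a / (l * p) + 1) := by field_simp; ring
      _ ≤ p * Real.exp (a / (l * p)) := by
          gcongr
          exact Real.add_one_le_exp _
  calc Real.exp (l * t) * (p + a / l) ^ m
      ≤ Real.exp (l * t) * Real.exp (Real.log p + a / (l * p)) ^ m := by gcongr
    _ = _ := by
        rw [← Real.exp_nat_mul, ← Real.exp_add, one_div, Real.log_inv]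
        congr 1
        ring

/-- If `H ≥ ξ 1 + ⋯ + ξ m` a.s., the `ξ i` are nonnegative, and
`P(ξ i ≤ t | σ(ξ 1, …, ξ (i-1))) ≤ p + a t` a.s. for all `t > 0`, then
`log P(H ≤ t) ≤ 2 √(a m t / p) − m log (1/p)` for every `t > 0`
(the left-hand side being `−∞` if `P(H ≤ t) = 0`). -/
theorem statement0 {Ω : Type*} [MeasurableSpace Ω] (P : Measure Ω) [IsProbabilityMeasure P]
    (m : ℕ) (ξ : Fin m → Ω → ℝ) (H : Ω → ℝ)
    (hξmeas : ∀ i, Measurable (ξ i)) (hHmeas : Measurable H)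
    (hξnonneg : ∀ i x, 0 ≤ ξ i x) (hHnonneg : ∀ x, 0 ≤ H x)
    (hdom : ∀ᵐ x ∂P, ∑ i, ξ i x ≤ H x)
    (p a : ℝ) (hp : p ∈ Set.Ioo (0 : ℝ) 1) (ha : 0 < a)
    (hcond : ∀ (i : Fin m) (t : ℝ), 0 < t →
      ∀ᵐ x ∂P,
        (P[Set.indicator {y | ξ i y ≤ t} (fun _ => (1 : ℝ)) | pastSigma ξ i]) x ≤ p + a * t) :
    ∀ t : ℝ, 0 < t →
      ENNReal.log (P {x | H x ≤ t}) ≤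
        ((2 * Real.sqrt (a * m * t / p) - m * Real.log (1 / p) : ℝ) : EReal) := by
  intro t ht
  obtain ⟨hp0, -⟩ := hp
  rcases Nat.eq_zero_or_pos m with rfl | hm
  · simpa using (prob_le_one : P {x | H x ≤ t} ≤ 1)
  have hm' : (0 : ℝ) < m := Nat.cast_pos.2 hm
  set s := Real.sqrt (a * m * t / p) with hs
  have hs0 : 0 < s := Real.sqrt_pos.2 (by positivity)
  have hs2 : s ^ 2 = a * m * t / p := Real.sq_sqrt (by positivity)
  have hl : 0 < s / t := div_pos hs0 ht
  have hmgf := lintegral_exp_neg_sum_le (P := P) hξmeas hξnonneg hp0.le ha.le hl hcond le_rfl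
  simp only [Fin.is_lt, Finset.filter_true] at hmgf
  rw [← ENNReal.ofReal_pow (by positivity)] at hmgf
  have hP := (measure_le_le_of_lintegral_exp_neg_le
    (Finset.measurable_fun_sum _ fun i _ => hξmeas i) hdom hl.le hmgf t).trans
    (ENNReal.ofReal_le_ofReal (exp_mul_add_div_pow_le hp0 ha.le hl m))
  have hexponent : s / t * t + m * (a / (s / t * p)) = 2 * s := by
    have hsm : m * (a / (s / t * p)) = s := by
      rw [eq_div_iff hp0.ne'] at hs2
      field_simp
      linarith
    rw [hsm, div_mul_cancel₀ _ ht.ne']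
    ring
  rw [hexponent] at hP
  calc ENNReal.log (P {x | H x ≤ t}) ≤ _ := ENNReal.log_le_log hP
    _ = _ := by rw [ENNReal.log_ofReal_of_pos (Real.exp_pos _), Real.log_exp]
end

section
/- For every nonempty finite set A ⊂ Z^d, all x, y ∈ A, and all positive reals t, s, v with s + v ≤ t, one has |(L^A P^A_t 1_{{y}})(x)| / θ(y) ≤ (1/s)·√( p^A_{2v}(x,x) · p^A_{2(t−s−v)}(y,y) ); the left-hand side equals |∂_t p^A_t(x,y)|. -/
/-- Vertices of the lattice `ℤ^d`. -/
abbrev V (d : ℕ) := Fin d → ℤ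

/-- The `i`-th unit vector of `ℤ^d`. -/
def unitv {d : ℕ} (i : Fin d) : V d := fun j => if j = i then 1 else 0

/-- Index set for the (unordered) nearest-neighbour edges of `ℤ^d`:
`(x, i)` stands for the edge `{x, x + unitv i}`. -/
abbrev OEdge (d : ℕ) := V d × Fin d

/-- The Dirichlet generator `L^A` on a finite set `A ⊂ ℤ^d`:
`L^A f (x) = θ(x)⁻¹ ∑_y ω_{xy} (f̃(y) − f(x))` for `x ∈ A` (and `0` outside `A`),
where `f̃` is the extension of `f` by `0` outside `A`, `w (x,i)` is the conductance of the
edge `{x, x + unitv i}` and `θ` is the reference weight. -/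
noncomputable def genA {d : ℕ} (w : OEdge d → ℝ) (θ : V d → ℝ) (A : Finset (V d))
    (f : V d → ℝ) : V d → ℝ := fun x =>
  if x ∈ A then
    (θ x)⁻¹ * ∑ i : Fin d,
      (w (x, i) * ((A : Set (V d)).indicator f (x + unitv i) - f x) +
       w (x - unitv i, i) * ((A : Set (V d)).indicator f (x - unitv i) - f x))
  else 0

/-- The Dirichlet semigroup `P^A_t f = e^{t L^A} (f restricted to A)`, computed pointwise by
the exponential series (the series converges since `L^A` is a bounded operator preserving
functions supported in the finite set `A`). -/
noncomputable def heatA {d : ℕ} (w : OEdge d → ℝ) (θ : V d → ℝ) (A : Finset (V d))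
    (f : V d → ℝ) (t : ℝ) : V d → ℝ := fun x =>
  ∑' n : ℕ, t ^ n / (n.factorial : ℝ) * ((genA w θ A)^[n] ((A : Set (V d)).indicator f)) x

/-- The `ℓ²(A, θ)` norm. -/
noncomputable def l2norm {d : ℕ} (θ : V d → ℝ) (A : Finset (V d)) (g : V d → ℝ) : ℝ :=
  Real.sqrt (∑ x ∈ A, g x ^ 2 * θ x)

/-- The Dirichlet heat kernel `p^A_t(x,y) = (P^A_t 1_{{y}})(x) / θ(y)`. -/
noncomputable def hkA {d : ℕ} (w : OEdge d → ℝ) (θ : V d → ℝ) (A : Finset (V d))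
    (t : ℝ) (x y : V d) : ℝ :=
  heatA w θ A (fun z => if z = y then 1 else 0) t x / θ y

/-- The Dirichlet generator as a linear map. -/
noncomputable def genLin {d : ℕ} (w : OEdge d → ℝ) (θ : V d → ℝ) (A : Finset (V d)) :
    (V d → ℝ) →ₗ[ℝ] (V d → ℝ) where
  toFun := genA w θ A
  map_add' f g := by
    ext x
    simp only [genA, Pi.add_apply]
    split_ifs
    · rw [← mul_add, ← Finset.sum_add_distrib]
      congr 1
      refine Finset.sum_congr rfl fun i _ => ?_
      simp only [Set.indicator_add', Pi.add_apply]
      ring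
    · simp
  map_smul' c f := by
    ext x
    simp only [genA, Pi.smul_apply, smul_eq_mul, RingHom.id_apply]
    split_ifs
    · rw [mul_left_comm c, Finset.mul_sum _ _ c]
      refine congrArg _ (Finset.sum_congr rfl fun i _ => ?_)
      have h (u : V d) : (A : Set (V d)).indicator (c • f) u =
          c * (A : Set (V d)).indicator f u :=
        Set.indicator_const_smul_apply _ c f u
      rw [h, h]
      ring
    · simp

/-- The generator is symmetric with respect to the weight `θ`. -/
theorem genA_single_symm {d : ℕ} (w : OEdge d → ℝ) {θ : V d → ℝ} (hθ : ∀ x, 0 < θ x)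
    (A : Finset (V d)) {x y : V d} (hx : x ∈ A) (hy : y ∈ A) :
    θ x * genA w θ A (Pi.single y 1) x = θ y * genA w θ A (Pi.single x 1) y := by
  have hind : ∀ z ∈ A, (A : Set (V d)).indicator (Pi.single z (1 : ℝ)) = Pi.single z 1 := by
    intro z hz
    refine Set.indicator_eq_self.2 fun u hu => ?_
    by_cases h : u = z
    · simpa [h] using hz
    · exact absurd (Pi.single_eq_of_ne h 1) hu
  rcases eq_or_ne x y with rfl | hxy
  · rfl
  simp only [genA, if_pos hx, if_pos hy, hind x hx, hind y hy,
    mul_inv_cancel_left₀ (hθ _).ne']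
  refine Finset.sum_congr rfl fun i _ => ?_
  have h1 : x + unitv i = y ↔ y - unitv i = x := by
    rw [sub_eq_iff_eq_add, eq_comm]
  have h2 : x - unitv i = y ↔ y + unitv i = x := by
    rw [sub_eq_iff_eq_add, eq_comm]
  simp only [Pi.single_apply, hxy, hxy.symm, h1, h2]
  by_cases h3 : y - unitv i = x <;> by_cases h4 : y + unitv i = x <;> simp [h3, h4]
  · rw [h2.2 h4]
    ring
  · rw [← h2.2 h4]

/-- Eigenvalues of the Dirichlet generator are nonpositive, by the maximum principle. -/
theorem eigenvalue_nonpos {d : ℕ} {w : OEdge d → ℝ} (hw : ∀ e, 0 ≤ w e)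
    {θ : V d → ℝ} (hθ : ∀ x, 0 < θ x) {A : Finset (V d)} {f : V d → ℝ} {l : ℝ}
    (hf : ∃ z ∈ A, f z ≠ 0) (h : ∀ x ∈ A, genA w θ A f x = l * f x) : l ≤ 0 := by
  obtain ⟨z, hz, hfz⟩ := hf
  obtain ⟨x, hx, hmax⟩ := A.exists_max_image (fun x => |f x|) ⟨z, hz⟩
  have hfx : 0 < f x ^ 2 := by
    have : 0 < |f x| := (abs_pos.2 hfz).trans_le (hmax z hz)
    exact pow_pos this 2 |>.trans_eq (sq_abs _)
  have hbound : ∀ u, ((A : Set (V d)).indicator f u - f x) * f x ≤ 0 := by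
    intro u
    have h1 : |(A : Set (V d)).indicator f u| ≤ |f x| := by
      by_cases hu : u ∈ A
      · rw [Set.indicator_of_mem (by simpa using hu)]
        exact hmax u hu
      · rw [Set.indicator_of_notMem (by simpa using hu)]
        simp
    have h2 : (A : Set (V d)).indicator f u * f x ≤ |f x| * |f x| :=
      (le_abs_self _).trans (by rw [abs_mul]; gcongr)
    rw [abs_mul_abs_self] at h2
    linarith
  have key : genA w θ A f x * f x ≤ 0 := by
    rw [genA, if_pos hx, mul_assoc, Finset.sum_mul]
    refine mul_nonpos_of_nonneg_of_nonpos (inv_nonneg.2 (hθ x).le)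
      (Finset.sum_nonpos fun i _ => ?_)
    rw [add_mul, mul_assoc, mul_assoc]
    exact add_nonpos (mul_nonpos_of_nonneg_of_nonpos (hw _) (hbound _))
      (mul_nonpos_of_nonneg_of_nonpos (hw _) (hbound _))
  rw [h x hx, mul_assoc, ← sq] at key
  exact nonpos_of_mul_nonpos_left key hfx

/-- Spectral decomposition of the Dirichlet generator in `ℓ²(A, θ)`. -/
theorem exists_eigenfunctions {d : ℕ} {w : OEdge d → ℝ} (hw : ∀ e, 0 ≤ w e)
    {θ : V d → ℝ} (hθ : ∀ x, 0 < θ x) (A : Finset (V d)) :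
    ∃ (l : A → ℝ) (φ : A → V d → ℝ), (∀ i, l i ≤ 0) ∧
      (∀ i, genA w θ A (φ i) = l i • φ i) ∧
      ∀ y ∈ A, (Pi.single y 1 : V d → ℝ) = ∑ i, (φ i y * θ y) • φ i := by
  have hsq : ∀ x, 0 < √(θ x) := fun x => Real.sqrt_pos.2 (hθ x)
  let S : Matrix A A ℝ := fun x y => √(θ x) * genA w θ A (Pi.single y.1 1) x / √(θ y)
  have hS : S.IsHermitian := by
    ext x y
    have h := genA_single_symm w hθ A x.2 y.2
    have e1 := Real.mul_self_sqrt (hθ x).le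
    have e2 := Real.mul_self_sqrt (hθ y).le
    rw [Matrix.conjTranspose_apply, star_trivial]
    change √(θ y) * genA w θ A (Pi.single x.1 1) y / √(θ x) =
      √(θ x) * genA w θ A (Pi.single y.1 1) x / √(θ y)
    rw [div_eq_div_iff (hsq _).ne' (hsq _).ne']
    linear_combination e2 * genA w θ A (Pi.single x.1 1) y
      - e1 * genA w θ A (Pi.single y.1 1) x - h
  let u := hS.eigenvectorBasis
  let φ : A → V d → ℝ := fun i x => if h : x ∈ A then u i ⟨x, h⟩ / √(θ x) else 0
  have hφ : ∀ i (x : A), φ i x = u i x / √(θ x) := fun i x => by simp [φ]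
  have heig : ∀ i, genA w θ A (φ i) = hS.eigenvalues i • φ i := by
    intro i
    ext x
    by_cases hx : x ∈ A
    · have hsum : φ i = ∑ y : A, φ i y • (Pi.single y.1 1 : V d → ℝ) := by
        ext z
        by_cases hz : z ∈ A
        · rw [Finset.sum_apply, Finset.sum_eq_single ⟨z, hz⟩]
          · simp
          · intro b _ hb
            have : z ≠ b := fun h => hb (Subtype.ext h.symm)
            simp [this]
          · simp
        · rw [Finset.sum_apply, Finset.sum_eq_zero]
          · simp [φ, hz]
          · intro b _
            have : z ≠ b := fun h => hz (h ▸ b.2)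
            simp [this]
      have hm := congrFun (hS.mulVec_eigenvectorBasis i) ⟨x, hx⟩
      simp only [Matrix.mulVec, dotProduct, Pi.smul_apply, smul_eq_mul] at hm
      have hL : genA w θ A (φ i) x = ∑ y : A, φ i y * genA w θ A (Pi.single y.1 1) x := by
        change genLin w θ A (φ i) x = _
        conv_lhs => rw [hsum]
        rw [map_sum, Finset.sum_apply]
        refine Finset.sum_congr rfl fun y _ => ?_
        rw [map_smul]
        rfl
      have hx' := hφ i ⟨x, hx⟩
      simp only at hx'
      rw [hL, Pi.smul_apply, smul_eq_mul, hx', mul_div_assoc', eq_div_iff (hsq x).ne']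
      refine Eq.trans ?_ hm
      rw [Finset.sum_mul]
      refine Finset.sum_congr rfl fun y _ => ?_
      rw [hφ]
      simp only [S, u]
      ring
    · simp [genA, hx, φ]
  refine ⟨hS.eigenvalues, φ, fun i => ?_, heig, fun y hy => ?_⟩
  · refine eigenvalue_nonpos hw hθ (f := φ i) ?_ fun x _ => by rw [heig]; rfl
    by_contra! hcon
    refine u.orthonormal.ne_zero i ?_
    ext x
    have := hcon x x.2
    rw [hφ] at this
    simpa [(hsq x).ne'] using this
  · ext x
    by_cases hx : x ∈ A
    · have h := congrArg (fun f => f ⟨x, hx⟩)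
        (u.sum_repr (EuclideanSpace.single (⟨y, hy⟩ : A) (1 : ℝ)))
      replace h : ∑ i, u i ⟨y, hy⟩ * u i ⟨x, hx⟩ = if x = y then 1 else 0 := by
        simpa [u.repr_apply_apply, EuclideanSpace.inner_single_right] using h
      have hx' := fun i => hφ i ⟨x, hx⟩
      have hy' := fun i => hφ i ⟨y, hy⟩
      simp only at hx' hy'
      simp only [Finset.sum_apply, Pi.smul_apply, smul_eq_mul, hx', hy']
      have e : ∀ i, u i ⟨y, hy⟩ / √(θ y) * θ y * (u i ⟨x, hx⟩ / √(θ x)) =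
          √(θ y) / √(θ x) * (u i ⟨y, hy⟩ * u i ⟨x, hx⟩) := fun i => by
        have := (hsq y).ne'
        field_simp
        rw [Real.sq_sqrt (hθ y).le]
      rw [Finset.sum_congr rfl fun i _ => e i, ← Finset.mul_sum, h]
      by_cases hxy : x = y
      · subst hxy
        simp [(hsq x).ne']
      · simp [hxy]
    · have : x ≠ y := fun h => hx (h ▸ hy)
      rw [Finset.sum_apply, Finset.sum_eq_zero] <;> simp [this, φ, hx]

/-- The heat semigroup acts diagonally on combinations of eigenfunctions supported in `A`. -/
theorem heatA_eq_sum {d : ℕ} {w : OEdge d → ℝ} {θ : V d → ℝ} {A : Finset (V d)}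
    {ι : Type*} [Fintype ι] {l c : ι → ℝ} {φ : ι → V d → ℝ}
    (hφ : ∀ i, genA w θ A (φ i) = l i • φ i) {f : V d → ℝ}
    (hf : (A : Set (V d)).indicator f = ∑ i, c i • φ i) (t : ℝ) :
    heatA w θ A f t = ∑ i, (Real.exp (t * l i) * c i) • φ i := by
  have hit : ∀ n : ℕ, (genA w θ A)^[n] ((A : Set (V d)).indicator f) =
      ∑ i, (l i ^ n * c i) • φ i := by
    intro n
    induction n with
    | zero => simpa using hf
    | succ n ih =>
      rw [Function.iterate_succ_apply', ih]
      change genLin w θ A _ = _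
      rw [map_sum]
      refine Finset.sum_congr rfl fun i _ => ?_
      rw [map_smul]
      change _ • genA w θ A (φ i) = _
      rw [hφ, smul_smul]
      congr 1
      ring
  ext x
  simp only [heatA, hit]
  refine HasSum.tsum_eq ?_
  simp only [Finset.sum_apply, Pi.smul_apply, smul_eq_mul, Finset.mul_sum]
  refine hasSum_sum fun i _ => ?_
  have h := NormedSpace.expSeries_div_hasSum_exp (t * l i)
  rw [← Real.exp_eq_exp_ℝ] at h
  rw [mul_assoc]
  refine (h.mul_right (c i * φ i x)).congr_fun fun n => ?_
  rw [mul_pow]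
  ring

/-- For a nonempty finite `A ⊂ ℤ^d`, all `x, y ∈ A` and positive reals
`t, s, v` with `s + v ≤ t`, one has
`|(L^A P^A_t 1_{{y}})(x)| / θ(y) ≤ (1/s) √(p^A_{2v}(x,x) p^A_{2(t−s−v)}(y,y))`;
the left-hand side equals `|∂_t p^A_t(x,y)|`. -/
theorem statement2 (d : ℕ) (w : OEdge d → ℝ) (hw : ∀ e, 0 ≤ w e)
    (θ : V d → ℝ) (hθ : ∀ x, 0 < θ x)
    (A : Finset (V d)) (hA : A.Nonempty) (x y : V d) (hx : x ∈ A) (hy : y ∈ A)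
    (t s v : ℝ) (ht : 0 < t) (hs : 0 < s) (hv : 0 < v) (hsv : s + v ≤ t) :
    |genA w θ A (heatA w θ A (fun z => if z = y then 1 else 0) t) x| / θ y ≤
      (1 / s) * Real.sqrt (hkA w θ A (2 * v) x x * hkA w θ A (2 * (t - s - v)) y y) := by
  obtain ⟨l, φ, hl, hφ, hcomp⟩ := exists_eigenfunctions hw hθ A
  have hheat : ∀ z ∈ A, ∀ r, heatA w θ A (fun u => if u = z then 1 else 0) r =
      ∑ i, (Real.exp (r * l i) * (φ i z * θ z)) • φ i := by
    intro z hz r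
    refine heatA_eq_sum hφ ?_ r
    rw [← hcomp z hz]
    ext u
    by_cases h : u = z
    · simp [h, hz]
    · simp [Set.indicator_apply, h]
  have hdiag : ∀ z ∈ A, ∀ r, hkA w θ A (2 * r) z z =
      ∑ i, (Real.exp (r * l i) * |φ i z|) ^ 2 := by
    intro z hz r
    rw [hkA, hheat z hz, Finset.sum_apply, Finset.sum_div]
    refine Finset.sum_congr rfl fun i _ => ?_
    rw [mul_pow, sq_abs, ← Real.exp_nat_mul, Pi.smul_apply, smul_eq_mul]
    have := (hθ z).ne'
    field_simp
    push_cast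
    ring_nf
  have hgen : genA w θ A (heatA w θ A (fun z => if z = y then 1 else 0) t) x =
      (∑ i, l i * Real.exp (t * l i) * φ i x * φ i y) * θ y := by
    rw [hheat y hy]
    change genLin w θ A _ x = _
    rw [map_sum, Finset.sum_apply, Finset.sum_mul]
    refine Finset.sum_congr rfl fun i _ => ?_
    rw [map_smul]
    change (_ • genA w θ A (φ i)) x = _
    rw [hφ]
    simp only [Pi.smul_apply, smul_eq_mul]
    ring
  rw [hgen, abs_mul, abs_of_pos (hθ y), mul_div_cancel_right₀ _ (hθ y).ne', hdiag x hx,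
    hdiag y hy, Real.sqrt_mul (Finset.sum_nonneg fun i _ => sq_nonneg _)]
  refine (Finset.abs_sum_le_sum_abs _ _).trans (le_trans ?_
    (mul_le_mul_of_nonneg_left (Real.sum_mul_le_sqrt_mul_sqrt Finset.univ _ _)
      (one_div_pos.2 hs).le))
  rw [Finset.mul_sum]
  refine Finset.sum_le_sum fun i _ => ?_
  have hexp : Real.exp (t * l i) =
      Real.exp (s * l i) * (Real.exp (v * l i) * Real.exp ((t - s - v) * l i)) := by
    rw [← Real.exp_add, ← Real.exp_add]
    congr 1
    ring
  have hle : |l i| * Real.exp (s * l i) ≤ 1 / s := by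
    rw [abs_of_nonpos (hl i), le_div_iff₀ hs]
    have h1 := Real.add_one_le_exp (-(s * l i))
    have h2 := Real.exp_pos (s * l i)
    have h3 : Real.exp (-(s * l i)) * Real.exp (s * l i) = 1 := by
      rw [← Real.exp_add, neg_add_cancel, Real.exp_zero]
    nlinarith
  calc |l i * Real.exp (t * l i) * φ i x * φ i y|
      = (|l i| * Real.exp (s * l i)) * (Real.exp (v * l i) * |φ i x| *
          (Real.exp ((t - s - v) * l i) * |φ i y|)) := by
        rw [abs_mul, abs_mul, abs_mul, Real.abs_exp, hexp]
        ring
    _ ≤ _ := by gcongr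
end
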